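/- Let a, b, b', c ∈ ℂ with Re a > 0, Re(c−a) > 0, b ∉ ℤ_{≤0}, c ∉ ℤ_{≤0}, a−b ∉ ℤ and c−b ∉ ℤ. Let x ∈ ℝ with x < −1 and y ∈ ℂ with |y| < 1. Define Φ(x,y) = [Γ(c)/(Γ(a)Γ(c−a))] ∫_0^1 t^{a−1}(1−t)^{c−a−1}(1−tx)^{−b}(1−ty)^{−b'} dt (this integral representation of Appell's F_1 converges absolutely). Then Φ(x,y) = (−1/x)^a · [Γ(c)Γ(b−a)/(Γ(b)Γ(c−a))] · F_1(a, a−c+1, b', a−b+1; 1/x, y/x) + (−1/x)^b · [Γ(c)Γ(a−b)/(Γ(a)Γ(c−b))] · G_2(b, b', a−b, b−c+1; −1/x, −y), where the F_1 and G_2 series on the right converge absolutely at the indicated arguments (note |1/x| < 1, |y/x| < 1, |−1/x| < 1 and |−y| < 1), and (−1/x)^a, (−1/x)^b are principal powers of the positive real number −1/x. -/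

import Mathlib

open MeasureTheory Complex

noncomputable section

/-- The Pochhammer symbol `(a)ₖ = a(a+1)⋯(a+k-1)` for `k ∈ ℕ`. -/
def poch (a : ℂ) (k : ℕ) : ℂ := ∏ i ∈ Finset.range k, (a + i)

/-- The Pochhammer symbol `(a)ₖ = Γ(a+k)/Γ(a)` for `k ∈ ℤ`. -/
def pochZ (a : ℂ) (k : ℤ) : ℂ := Complex.Gamma (a + k) / Complex.Gamma a

/-- The general term of Appell's hypergeometric series `F₁(a,b,b',c;x,y)`. -/
def F1term (a b b' c : ℂ) (x y : ℂ) (p : ℕ × ℕ) : ℂ :=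
  poch a (p.1 + p.2) * poch b p.1 * poch b' p.2 /
      (poch c (p.1 + p.2) * (Nat.factorial p.1 : ℂ) * (Nat.factorial p.2 : ℂ)) *
    x ^ p.1 * y ^ p.2

/-- The general term of Horn's hypergeometric series `G₂(α,β,γ,δ;x,y)`. -/
def G2term (α β γ δ : ℂ) (x y : ℂ) (p : ℕ × ℕ) : ℂ :=
  poch α p.1 * poch β p.2 * pochZ γ ((p.2 : ℤ) - (p.1 : ℤ)) *
      pochZ δ ((p.1 : ℤ) - (p.2 : ℤ)) /
      ((Nat.factorial p.1 : ℂ) * (Nat.factorial p.2 : ℂ)) *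
    x ^ p.1 * y ^ p.2

/-- The coefficient `(β)ₙ / n!` of the binomial series of `(1 - z) ^ (-β)`. -/
def coef (β : ℂ) (n : ℕ) : ℂ := poch β n / (Nat.factorial n : ℂ)

lemma poch_succ (β : ℂ) (n : ℕ) : poch β (n + 1) = poch β n * (β + n) :=
  Finset.prod_range_succ _ _

lemma poch_succ_left (β : ℂ) (n : ℕ) : poch β (n + 1) = β * poch (β + 1) n := by
  rw [poch, poch, Finset.prod_range_succ', mul_comm]
  congr 1
  · simp
  · refine Finset.prod_congr rfl fun i _ => ?_
    push_cast; ring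

lemma succ_mul_coef_succ (β : ℂ) (n : ℕ) :
    ((n : ℂ) + 1) * coef β (n + 1) = coef β n * (β + n) := by
  have h1 : (n : ℂ) + 1 ≠ 0 := by exact_mod_cast n.succ_ne_zero
  have h2 : (Nat.factorial n : ℂ) ≠ 0 := by exact_mod_cast n.factorial_ne_zero
  rw [coef, coef, poch_succ, Nat.factorial_succ]
  push_cast
  field_simp

lemma succ_mul_coef_succ_left (β : ℂ) (n : ℕ) :
    ((n : ℂ) + 1) * coef β (n + 1) = β * coef (β + 1) n := by
  have h1 : (n : ℂ) + 1 ≠ 0 := by exact_mod_cast n.succ_ne_zero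
  have h2 : (Nat.factorial n : ℂ) ≠ 0 := by exact_mod_cast n.factorial_ne_zero
  rw [coef, coef, poch_succ_left, Nat.factorial_succ]
  push_cast
  field_simp

lemma poch_eq_eval_ascPochhammer (β : ℂ) (n : ℕ) :
    poch β n = (ascPochhammer ℂ n).eval β := by
  induction n with
  | zero => simp [poch]
  | succ n ih => rw [poch_succ, ih, ascPochhammer_succ_eval]

lemma coef_eq_choose (β : ℂ) (n : ℕ) : Ring.choose (β + n - 1) n = coef β n := by
  have h2 : (Nat.factorial n : ℂ) ≠ 0 := by exact_mod_cast n.factorial_ne_zero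
  have h := Ring.factorial_nsmul_multichoose_eq_ascPochhammer β n
  rw [Polynomial.ascPochhammer_smeval_eq_eval, ← poch_eq_eval_ascPochhammer, nsmul_eq_mul] at h
  rw [coef, eq_div_iff h2, ← h, Ring.choose, mul_comm]
  congr 2
  ring

lemma one_sub_cpow_hasFPowerSeriesOnBall (β : ℂ) :
    HasFPowerSeriesOnBall (fun x : ℂ => 1 / (1 - x) ^ β)
      (FormalMultilinearSeries.ofScalars ℂ (coef β)) 0 1 := by
  simpa only [coef_eq_choose] using Complex.one_div_one_sub_cpow_hasFPowerSeriesOnBall_zero β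

lemma hasSum_coef_mul_pow (β : ℂ) {z : ℂ} (hz : ‖z‖ < 1) :
    HasSum (fun n => coef β n * z ^ n) ((1 - z) ^ (-β)) := by
  have h := (one_sub_cpow_hasFPowerSeriesOnBall β).hasSum (y := z)
    (by rw [← ENNReal.ofReal_one, Metric.eball_ofReal]; simpa using hz)
  simpa [FormalMultilinearSeries.ofScalars_apply_eq, cpow_neg, mul_comm] using h

lemma summable_norm_coef_mul_pow (β : ℂ) {r : ℝ} (h0 : 0 ≤ r) (h1 : r < 1) :
    Summable fun n => ‖coef β n‖ * r ^ n := by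
  have h := (FormalMultilinearSeries.ofScalars ℂ (coef β)).summable_norm_mul_pow
    (r := r.toNNReal) (lt_of_lt_of_le (by
      rw [ENNReal.coe_lt_one_iff, Real.toNNReal_lt_one]; exact h1) (one_sub_cpow_hasFPowerSeriesOnBall β).r_le)
  simpa [FormalMultilinearSeries.ofScalars_norm, h0] using h

lemma summable_succ_mul_norm_coef_mul_pow (β : ℂ) {r : ℝ} (h0 : 0 ≤ r) (h1 : r < 1) :
    Summable fun n : ℕ => ((n : ℝ) + 1) * (‖coef β n‖ * r ^ n) := by
  have hA : Summable fun n : ℕ => (n : ℝ) * (‖coef β n‖ * r ^ n) := by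
    rw [← summable_nat_add_iff 1]
    refine ((summable_norm_coef_mul_pow (β + 1) h0 h1).mul_left (‖β‖ * r)).congr fun n => ?_
    have := congrArg norm (succ_mul_coef_succ_left β n)
    rw [norm_mul, norm_mul, show ‖(n : ℂ) + 1‖ = (n : ℝ) + 1 by
      rw [← Nat.cast_succ, Complex.norm_natCast]; simp] at this
    push_cast
    rw [pow_succ]
    linear_combination (-r * r ^ n) * this
  exact (hA.add (summable_norm_coef_mul_pow β h0 h1)).congr fun n => by ring

lemma exists_norm_coef_succ_le (β : ℂ) :
    ∃ C : ℝ, ∀ n : ℕ, 1 ≤ n → ‖coef β (n + 1)‖ ≤ C * (n : ℝ) ^ (β.re - 1) := by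
  have hbdd : ∃ C : ℝ, ∀ n : ℕ, ‖(Complex.GammaSeq β n)⁻¹‖ ≤ C := by
    suffices h : ∃ l, Filter.Tendsto (fun n => (Complex.GammaSeq β n)⁻¹) Filter.atTop (nhds l) by
      obtain ⟨l, hl⟩ := h
      obtain ⟨C, hC⟩ := hl.norm.bddAbove_range
      exact ⟨C, fun n => hC ⟨n, rfl⟩⟩
    by_cases hΓ : Complex.Gamma β = 0
    · obtain ⟨m, hm⟩ := Complex.Gamma_eq_zero_iff β |>.1 hΓ
      refine ⟨0, tendsto_const_nhds.congr' ?_⟩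
      filter_upwards [Filter.eventually_ge_atTop m] with n hn
      rw [Complex.GammaSeq, Finset.prod_eq_zero (i := m) (by simp; omega) (by rw [hm]; ring)]
      simp
    · exact ⟨_, (Complex.GammaSeq_tendsto_Gamma β).inv₀ hΓ⟩
  obtain ⟨C, hC⟩ := hbdd
  have hC0 : 0 ≤ C := (norm_nonneg _).trans (hC 0)
  refine ⟨C, fun n hn => ?_⟩
  have hn0 : (0 : ℝ) < n := by exact_mod_cast hn
  have hnc : (n : ℂ) ≠ 0 := by exact_mod_cast hn0.ne'
  have h1 : (n : ℂ) + 1 ≠ 0 := by exact_mod_cast n.succ_ne_zero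
  have h2 : (Nat.factorial n : ℂ) ≠ 0 := by exact_mod_cast n.factorial_ne_zero
  have hp : (n : ℂ) ^ β ≠ 0 := by simp [Complex.cpow_eq_zero_iff, hnc]
  have e : coef β (n + 1) = (n : ℂ) ^ β / ((n : ℂ) + 1) * (Complex.GammaSeq β n)⁻¹ := by
    rw [coef, Complex.GammaSeq, poch, Nat.factorial_succ, inv_div]
    push_cast
    field_simp
  rw [e, norm_mul, norm_div, Complex.norm_natCast_cpow_of_pos (by omega)]
  rw [show ‖(n : ℂ) + 1‖ = (n : ℝ) + 1 by
      rw [← Nat.cast_succ, Complex.norm_natCast]; simp, mul_comm C]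
  refine mul_le_mul ?_ (hC n) (norm_nonneg _) (by positivity)
  rw [Real.rpow_sub_one hn0.ne']
  gcongr
  linarith

lemma tendsto_coef_zero {D : ℂ} (hD : 0 < D.re) :
    Filter.Tendsto (coef (1 - D)) Filter.atTop (nhds 0) := by
  obtain ⟨C, hC⟩ := exists_norm_coef_succ_le (1 - D)
  rw [← Filter.tendsto_add_atTop_iff_nat 1]
  refine squeeze_zero_norm' (a := fun n : ℕ => C * (n : ℝ) ^ (-D.re)) ?_ ?_
  · filter_upwards [Filter.eventually_ge_atTop 1] with n hn
    simpa using hC n hn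
  · simpa using ((tendsto_rpow_neg_atTop hD).comp tendsto_natCast_atTop_atTop).const_mul C

lemma summable_norm_coef_div {D : ℂ} (hD : 0 < D.re) :
    Summable fun n : ℕ => ‖coef (1 - D) n‖ / ((n : ℝ) + 1) := by
  obtain ⟨C, hC⟩ := exists_norm_coef_succ_le (1 - D)
  rw [← summable_nat_add_iff 1]
  have hs : Summable fun n : ℕ => C * (n : ℝ) ^ (-D.re - 1) :=
    (Real.summable_nat_rpow.2 (by linarith)).mul_left C
  refine hs.of_norm_bounded_eventually_nat ?_
  filter_upwards [Filter.eventually_ge_atTop 1] with n hn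
  have hn0 : (0 : ℝ) < n := by exact_mod_cast hn
  rw [Real.norm_of_nonneg (by positivity), Real.rpow_sub_one hn0.ne', ← mul_div_assoc]
  have := hC n hn
  simp only [sub_re, one_re, sub_sub_cancel_left] at this
  have h3 := (norm_nonneg _).trans this
  push_cast
  gcongr
  linarith

lemma exists_le_norm_add_intCast {α : ℂ} (hα : ∀ k : ℤ, α ≠ (k : ℂ)) :
    ∃ δ : ℝ, 0 < δ ∧ ∀ j : ℤ, δ * (1 + |(j : ℝ)|) ≤ ‖α + j‖ := by
  have hne : (Set.range ((↑) : ℤ → ℂ)).Nonempty := ⟨_, 0, rfl⟩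
  have hd := (Complex.isClosed_range_intCast.notMem_iff_infDist_pos hne (x := α)).1
    (by rintro ⟨k, hk⟩; exact hα k hk.symm)
  set d := Metric.infDist α (Set.range ((↑) : ℤ → ℂ))
  have hdj (j : ℤ) : d ≤ ‖α + j‖ := by
    have := Metric.infDist_le_dist_of_mem (x := α) (s := Set.range ((↑) : ℤ → ℂ)) ⟨-j, rfl⟩
    simpa [dist_eq_norm] using this
  have hn := norm_nonneg α
  refine ⟨d / (1 + d + ‖α‖), by positivity, fun j => ?_⟩
  rw [div_mul_eq_mul_div, div_le_iff₀ (by positivity)]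
  have h1 : |(j : ℝ)| ≤ ‖α + j‖ + ‖α‖ := by
    have := norm_sub_le (α + j) α
    rwa [add_sub_cancel_left, Complex.norm_intCast] at this
  nlinarith [hdj j]

lemma ofReal_cpow_eq_exp {p : ℝ} (hp : 0 < p) (z : ℂ) :
    (p : ℂ) ^ z = Complex.exp ((Real.log p : ℂ) * z) := by
  rw [Complex.cpow_def_of_ne_zero (by exact_mod_cast hp.ne'), Complex.ofReal_log hp.le]

lemma integrableOn_cpow_sub_one {β : ℂ} (hβ : 0 < β.re) :
    IntegrableOn (fun t : ℝ => (t : ℂ) ^ (β - 1)) (Set.Ioo 0 1) := by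
  rw [intervalIntegral.integrableOn_Ioo_cpow_iff zero_lt_one]
  simpa using hβ

lemma integral_cpow_sub_one {β : ℂ} (hβ : 0 < β.re) :
    ∫ t in Set.Ioo (0 : ℝ) 1, (t : ℂ) ^ (β - 1) = 1 / β := by
  have hβ0 : β ≠ 0 := by rintro rfl; simp at hβ
  rw [← integral_Ioc_eq_integral_Ioo, ← intervalIntegral.integral_of_le zero_le_one,
    integral_cpow (Or.inl (by simpa using hβ))]
  simp [hβ0]

lemma integral_norm_cpow_sub_one {β : ℂ} (hβ : 0 < β.re) :
    ∫ t in Set.Ioo (0 : ℝ) 1, ‖(t : ℂ) ^ (β - 1)‖ = 1 / β.re := by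
  have : ∫ t in Set.Ioo (0 : ℝ) 1, ‖(t : ℂ) ^ (β - 1)‖ =
      ∫ t in Set.Ioo (0 : ℝ) 1, t ^ (β.re - 1) := by
    refine setIntegral_congr_fun measurableSet_Ioo fun t ht => ?_
    simp [Complex.norm_cpow_eq_rpow_re_of_pos ht.1]
  rw [this, ← integral_Ioc_eq_integral_Ioo, ← intervalIntegral.integral_of_le zero_le_one,
    integral_rpow (Or.inl (by linarith))]
  simp [hβ.ne']

/-- Termwise integration of a series of powers against `t ^ (α - 1) * g t` on `(0, 1)`. -/
lemma hasSum_mul_integral_cpow {ι : Type*} [Countable ι] {α : ℂ} (hα : 0 < α.re)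
    {g : ℝ → ℂ} (hg : ContinuousOn g (Set.Icc 0 1)) (w : ι → ℂ) (e : ι → ℕ)
    (hw : Summable fun i => ‖w i‖ / ((e i : ℝ) + 1)) {h : ℝ → ℂ}
    (hh : ∀ t ∈ Set.Ioo (0 : ℝ) 1, HasSum (fun i => w i * (t : ℂ) ^ e i) (h t)) :
    HasSum (fun i => w i * ∫ t in Set.Ioo (0 : ℝ) 1, (t : ℂ) ^ (α + e i - 1) * g t)
      (∫ t in Set.Ioo (0 : ℝ) 1, (t : ℂ) ^ (α - 1) * g t * h t) := by
  obtain ⟨M, hM⟩ :=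
    (isCompact_Icc (a := (0 : ℝ)) (b := 1)).exists_bound_of_continuousOn hg
  have hM0 : 0 ≤ M := (norm_nonneg _).trans (hM 0 (by simp))
  have hre (i : ι) : 0 < (α + e i).re := by simp; positivity
  have hintg (i : ι) : IntegrableOn (fun t : ℝ => (t : ℂ) ^ (α + e i - 1) * g t)
      (Set.Ioo 0 1) :=
    (integrableOn_cpow_sub_one (hre i)).mul_continuousOn_of_subset hg measurableSet_Ioo
      isCompact_Icc Set.Ioo_subset_Icc_self
  have key := hasSum_integral_of_summable_integral_norm
    (μ := volume.restrict (Set.Ioo (0 : ℝ) 1))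
    (F := fun i t => w i * ((t : ℂ) ^ (α + e i - 1) * g t)) (fun i => (hintg i).const_mul _) ?_
  · simp only [integral_const_mul] at key
    refine (congrArg (HasSum _) (setIntegral_congr_fun measurableSet_Ioo fun t ht => ?_)).mp key
    have ht0 : (t : ℂ) ≠ 0 := by exact_mod_cast ht.1.ne'
    have := ((hh t ht).mul_left ((t : ℂ) ^ (α - 1) * g t)).tsum_eq
    rw [← this]
    refine tsum_congr fun i => ?_
    rw [show α + e i - 1 = (α - 1) + e i by ring, Complex.cpow_add _ _ ht0, Complex.cpow_natCast]
    ring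
  · obtain ⟨c, hc0, hc⟩ : ∃ c : ℝ, 0 < c ∧ ∀ n : ℕ, c * (n + 1) ≤ α.re + n := by
      refine ⟨min α.re 1, lt_min hα one_pos, fun n => ?_⟩
      have h1 := min_le_left α.re 1
      have h2 := min_le_right α.re 1
      have h3 : (0 : ℝ) ≤ n := n.cast_nonneg
      nlinarith
    refine Summable.of_nonneg_of_le (fun i => integral_nonneg fun t => norm_nonneg _)
      (fun i => ?_) (hw.mul_left (M / c))
    have h1 : ∫ t in Set.Ioo (0 : ℝ) 1, ‖w i * ((t : ℂ) ^ (α + e i - 1) * g t)‖ ≤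
        ∫ t in Set.Ioo (0 : ℝ) 1, ‖w i‖ * M * ‖(t : ℂ) ^ (α + e i - 1)‖ := by
      refine setIntegral_mono_on ((hintg i).const_mul _).norm
        ((integrableOn_cpow_sub_one (hre i)).norm.const_mul _) measurableSet_Ioo fun t ht => ?_
      rw [norm_mul, norm_mul]
      have := hM t (Set.Ioo_subset_Icc_self ht)
      have h4 := norm_nonneg (w i)
      have h5 := norm_nonneg ((t : ℂ) ^ (α + e i - 1))
      calc _ ≤ ‖w i‖ * (‖(t : ℂ) ^ (α + e i - 1)‖ * M) := by gcongr
        _ = _ := by ring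
    refine h1.trans ?_
    rw [integral_const_mul, integral_norm_cpow_sub_one (hre i)]
    have h2 : (α + e i).re = α.re + e i := by simp
    rw [h2]
    have h3 : 1 / (α.re + e i) ≤ 1 / (c * (e i + 1)) :=
      one_div_le_one_div_of_le (by positivity) (hc _)
    calc _ ≤ ‖w i‖ * M * (1 / (c * (e i + 1))) := by gcongr
      _ = _ := by field_simp

lemma integral_Ioo_beta {u v : ℂ} (hu : 0 < u.re) (hv : 0 < v.re) :
    ∫ t in Set.Ioo (0 : ℝ) 1, (t : ℂ) ^ (u - 1) * (1 - (t : ℂ)) ^ (v - 1) =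
      Complex.Gamma u * Complex.Gamma v / Complex.Gamma (u + v) := by
  rw [← Complex.betaIntegral_eq_Gamma_mul_div u v hu hv, Complex.betaIntegral,
    intervalIntegral.integral_of_le zero_le_one, integral_Ioc_eq_integral_Ioo]

lemma integrableOn_Ioo_beta {u v : ℂ} (hu : 0 < u.re) (hv : 0 < v.re) :
    IntegrableOn (fun t : ℝ => (t : ℂ) ^ (u - 1) * (1 - (t : ℂ)) ^ (v - 1)) (Set.Ioo 0 1) :=
  (intervalIntegrable_iff_integrableOn_Ioo_of_le zero_le_one).1
    (Complex.betaIntegral_convergent hu hv)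

lemma summable_coef_div_add {D α : ℂ} (hD : 0 < D.re) (hα : ∀ k : ℤ, α ≠ (k : ℂ)) :
    Summable fun k : ℕ => coef (1 - D) k / (α + k) := by
  obtain ⟨δ, hδ, h⟩ := exists_le_norm_add_intCast hα
  refine Summable.of_norm_bounded ((summable_norm_coef_div hD).mul_left δ⁻¹) fun k => ?_
  have := h k
  simp only [Int.cast_natCast, Nat.abs_cast] at this
  rw [norm_div]
  calc _ ≤ ‖coef (1 - D) k‖ / (δ * (1 + k)) := by gcongr
    _ = _ := by field_simp; ring

lemma tsum_coef_div_add_recurrence {D α : ℂ} (hD : 0 < D.re) (hα : ∀ k : ℤ, α ≠ (k : ℂ)) :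
    (α + D) * ∑' k : ℕ, coef (1 - D) k / (α + 1 + k) =
      α * ∑' k : ℕ, coef (1 - D) k / (α + k) := by
  have hα1 (k : ℤ) : α + 1 ≠ (k : ℂ) := fun h => hα (k - 1) (by push_cast; rw [← h]; ring)
  have h1 := (summable_coef_div_add hD hα1).hasSum.mul_left (α + D)
  have h2 := (summable_coef_div_add hD hα).hasSum.mul_left α
  have h3 := (h1.sub h2).tendsto_sum_nat
  obtain ⟨δ, hδ, h⟩ := exists_le_norm_add_intCast hα
  have hnz (k : ℕ) : α + k ≠ 0 := fun h => hα (-k) (by push_cast; linear_combination h)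
  have h4 (n : ℕ) : ∑ k ∈ Finset.range n, ((α + D) * (coef (1 - D) k / (α + 1 + k)) -
      α * (coef (1 - D) k / (α + k))) = -((n : ℂ) * coef (1 - D) n / (α + n)) := by
    induction n with
    | zero => simp
    | succ n ih =>
      rw [Finset.sum_range_succ, ih]
      have e := succ_mul_coef_succ (1 - D) n
      have n1 := hnz n
      have n2 := hnz (n + 1)
      push_cast at n2 ⊢
      rw [e]
      have n3 : α + 1 + n ≠ 0 := by convert n2 using 1; ring
      rw [show α + (n + 1) = α + 1 + n by ring]
      field_simp
      ring
  simp only [h4] at h3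
  have h5 : Filter.Tendsto (fun n : ℕ => -((n : ℂ) * coef (1 - D) n / (α + n)))
      Filter.atTop (nhds 0) := by
    rw [← neg_zero]
    refine Filter.Tendsto.neg ?_
    refine squeeze_zero_norm (a := fun n => δ⁻¹ * ‖coef (1 - D) n‖) (fun n => ?_) ?_
    · have := h n
      simp only [Int.cast_natCast, Nat.abs_cast] at this
      rw [norm_div, norm_mul, Complex.norm_natCast]
      have hn : (0 : ℝ) ≤ n := n.cast_nonneg
      rw [div_le_iff₀ (norm_pos_iff.2 (hnz n))]
      calc _ = δ⁻¹ * ‖coef (1 - D) n‖ * (δ * n) := by field_simp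
        _ ≤ _ := by gcongr; nlinarith
    · simpa using (tendsto_coef_zero hD).norm.const_mul δ⁻¹
  exact sub_eq_zero.1 (tendsto_nhds_unique h3 h5)

lemma tsum_coef_div_add {D α : ℂ} (hD : 0 < D.re) (hα : ∀ k : ℤ, α ≠ (k : ℂ))
    (hαD : ∀ k : ℤ, α + D ≠ (k : ℂ)) :
    ∑' k : ℕ, coef (1 - D) k / (α + k) =
      Complex.Gamma α * Complex.Gamma D / Complex.Gamma (α + D) := by
  obtain ⟨N, hN⟩ := exists_nat_gt (-α.re)
  induction N generalizing α with
  | zero =>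
    have hpos : 0 < α.re := by simpa using hN
    rw [← integral_Ioo_beta hpos hD]
    have key := hasSum_mul_integral_cpow hpos (g := fun _ => 1) continuousOn_const
      (coef (1 - D)) id (summable_norm_coef_div hD)
      (h := fun t => (1 - (t : ℂ)) ^ (D - 1)) fun t ht => by
        simpa using hasSum_coef_mul_pow (1 - D) (z := t)
          (by rw [Complex.norm_of_nonneg ht.1.le]; exact ht.2)
    simp only [mul_one] at key
    rw [← key.tsum_eq]
    refine tsum_congr fun k => ?_
    rw [integral_cpow_sub_one (by simp; positivity), mul_one_div]
    rfl
  | succ N ih =>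
    have hα0 : α ≠ 0 := by simpa using hα 0
    have hαD0 : α + D ≠ 0 := by simpa using hαD 0
    have hrec := tsum_coef_div_add_recurrence hD hα
    have := ih (α := α + 1) (fun k h => hα (k - 1) (by push_cast; rw [← h]; ring))
      (fun k h => hαD (k - 1) (by push_cast; rw [← h]; ring))
      (by simp at hN ⊢; linarith)
    rw [this, Complex.Gamma_add_one α hα0, show α + 1 + D = α + D + 1 by ring,
      Complex.Gamma_add_one _ hαD0] at hrec
    apply mul_left_cancel₀ hα0
    rw [← hrec]
    field_simp

/-- The Euler integral `∫₀¹ t ^ (A - 1) * (1 + t * X) ^ (-b) dt`. -/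
def eulerInt (A b : ℂ) (X : ℝ) : ℂ :=
  ∫ t in Set.Ioo (0 : ℝ) 1, (t : ℂ) ^ (A - 1) * (1 + (t : ℂ) * X) ^ (-b)

lemma one_add_mul_mem_slitPlane {X t : ℝ} (hX : 0 < X) (ht : 0 ≤ t) :
    1 + (t : ℂ) * X ∈ Complex.slitPlane := by
  rw [← Complex.ofReal_mul, ← Complex.ofReal_one, ← Complex.ofReal_add,
    Complex.ofReal_mem_slitPlane]
  positivity

lemma continuousOn_one_add_mul_cpow (b : ℂ) {X : ℝ} (hX : 0 < X) :
    ContinuousOn (fun t : ℝ => (1 + (t : ℂ) * X) ^ (-b)) (Set.Icc 0 1) :=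
  ContinuousOn.cpow (by fun_prop) continuousOn_const
    fun _ ht => one_add_mul_mem_slitPlane hX ht.1

lemma integrableOn_eulerInt {A : ℂ} (hA : 0 < A.re) (b : ℂ) {X : ℝ} (hX : 0 < X) :
    IntegrableOn (fun t : ℝ => (t : ℂ) ^ (A - 1) * (1 + (t : ℂ) * X) ^ (-b)) (Set.Ioo 0 1) :=
  (integrableOn_cpow_sub_one hA).mul_continuousOn_of_subset
    (continuousOn_one_add_mul_cpow b hX) measurableSet_Ioo isCompact_Icc Set.Ioo_subset_Icc_self

lemma integral_incomplete_beta_eq_eulerInt (A b : ℂ) {X : ℝ} (hX : 0 < X) :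
    ∫ w in Set.Ioo (0 : ℝ) (X / (1 + X)), (w : ℂ) ^ (A - 1) * (1 - (w : ℂ)) ^ (b - A - 1) =
      (X : ℂ) ^ A * eulerInt A b X := by
  have himg : (fun t : ℝ => t * X / (1 + t * X)) '' Set.Ioo 0 1 = Set.Ioo 0 (X / (1 + X)) := by
    ext w
    constructor
    · rintro ⟨t, ⟨h0, h1⟩, rfl⟩
      refine ⟨by positivity, ?_⟩
      simp only
      rw [div_lt_div_iff₀ (by positivity) (by positivity)]
      nlinarith
    · rintro ⟨h0, h1⟩
      rw [lt_div_iff₀ (by positivity)] at h1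
      have hw : 0 < 1 - w := by nlinarith
      refine ⟨w / (X * (1 - w)), ⟨by positivity, ?_⟩, ?_⟩
      · rw [div_lt_one (by positivity)]; linarith
      · simp only
        field_simp
        ring
  rw [← himg, integral_image_eq_integral_abs_deriv_smul (f' := fun t => X / (1 + t * X) ^ 2)
    measurableSet_Ioo]
  · rw [eulerInt, ← integral_const_mul]
    refine setIntegral_congr_fun measurableSet_Ioo fun t ht => ?_
    have ht0 := ht.1
    have hq : 0 < 1 + t * X := by positivity
    have e1 : (1 : ℂ) - ((t * X / (1 + t * X) : ℝ) : ℂ) = ((1 / (1 + t * X) : ℝ) : ℂ) := by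
      rw [← Complex.ofReal_one, ← Complex.ofReal_sub]
      congr 1
      field_simp
      ring
    have e2 : (1 : ℂ) + (t : ℂ) * X = ((1 + t * X : ℝ) : ℂ) := by push_cast; ring
    rw [e1, e2, abs_of_pos (by positivity), Complex.real_smul,
      ofReal_cpow_eq_exp (by positivity), ofReal_cpow_eq_exp (by positivity),
      ofReal_cpow_eq_exp hX, ofReal_cpow_eq_exp hq, ofReal_cpow_eq_exp ht0,
      Real.log_div (by positivity) (by positivity), Real.log_div (by positivity) (by positivity),
      Real.log_mul (by positivity) (by positivity), Real.log_one]
    have e3 : ((X / (1 + t * X) ^ 2 : ℝ) : ℂ) =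
        Complex.exp (((Real.log X - 2 * Real.log (1 + t * X) : ℝ)) : ℂ) := by
      rw [← Complex.ofReal_exp, Real.exp_sub, Real.exp_log hX, two_mul, Real.exp_add,
        Real.exp_log hq, sq]
    rw [e3]
    simp only [← Complex.exp_add]
    congr 1
    push_cast
    ring
  · intro t ht
    have hq : 1 + t * X ≠ 0 := by have := ht.1; positivity
    have h1 : HasDerivAt (fun t : ℝ => t * X) X t := by
      simpa using (hasDerivAt_id t).mul_const X
    have := h1.div (h1.const_add 1) hq
    refine HasDerivAt.hasDerivWithinAt ?_
    convert! this using 1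
    field_simp
    ring
  · intro s hs t ht h
    have h1 : 0 < 1 + s * X := by have := hs.1; positivity
    have h2 : 0 < 1 + t * X := by have := ht.1; positivity
    simp only at h
    rw [div_eq_div_iff h1.ne' h2.ne'] at h
    exact mul_right_cancel₀ hX.ne' (by linarith)

lemma integral_Ioo_comp_one_sub (f : ℝ → ℂ) {p : ℝ} (hp : p ≤ 1) :
    ∫ w in Set.Ioo (0 : ℝ) (1 - p), f (1 - w) = ∫ w in Set.Ioo p 1, f w := by
  rw [← integral_Ioc_eq_integral_Ioo, ← integral_Ioc_eq_integral_Ioo,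
    ← intervalIntegral.integral_of_le (by linarith), ← intervalIntegral.integral_of_le hp,
    intervalIntegral.integral_comp_sub_left]
  simp

lemma eulerInt_add_eulerInt {A b : ℂ} (hA : 0 < A.re) (hbA : 0 < (b - A).re) {X : ℝ}
    (hX : 0 < X) :
    (X : ℂ) ^ A * eulerInt A b X + ((X⁻¹ : ℝ) : ℂ) ^ (b - A) * eulerInt (b - A) b X⁻¹ =
      Complex.Gamma A * Complex.Gamma (b - A) / Complex.Gamma b := by
  have h0 := integral_Ioo_beta hA hbA
  have hi := integrableOn_Ioo_beta hA hbA
  have hp : X / (1 + X) ≤ 1 := by rw [div_le_one (by positivity)]; linarith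
  have hp0 : 0 ≤ X / (1 + X) := by positivity
  rw [add_sub_cancel] at h0
  rw [← h0, ← integral_incomplete_beta_eq_eulerInt A b hX,
    ← integral_incomplete_beta_eq_eulerInt (b - A) b (inv_pos.2 hX)]
  have e1 : X⁻¹ / (1 + X⁻¹) = 1 - X / (1 + X) := by field_simp; ring
  have h2 := integral_Ioo_comp_one_sub
    (fun w : ℝ => (w : ℂ) ^ (A - 1) * (1 - (w : ℂ)) ^ (b - A - 1)) hp
  rw [e1]
  have e2 : ∫ w in Set.Ioo (0 : ℝ) (1 - X / (1 + X)),
      (w : ℂ) ^ (b - A - 1) * (1 - (w : ℂ)) ^ (b - (b - A) - 1) =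
      ∫ w in Set.Ioo (X / (1 + X)) (1 : ℝ), (w : ℂ) ^ (A - 1) * (1 - (w : ℂ)) ^ (b - A - 1) := by
    rw [← h2]
    refine setIntegral_congr_fun measurableSet_Ioo fun t _ => ?_
    push_cast
    rw [sub_sub_cancel, sub_sub_cancel, mul_comm]
  rw [e2]
  have hi' := (intervalIntegrable_iff_integrableOn_Ioo_of_le zero_le_one).2 hi
  have i1 := hi'.mono_set (c := 0) (d := X / (1 + X))
    (by rw [Set.uIcc_of_le hp0, Set.uIcc_of_le zero_le_one]; exact Set.Icc_subset_Icc_right hp)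
  have i2 := hi'.mono_set (c := X / (1 + X)) (d := 1)
    (by rw [Set.uIcc_of_le hp, Set.uIcc_of_le zero_le_one]; exact Set.Icc_subset_Icc_left hp0)
  have := intervalIntegral.integral_add_adjacent_intervals i1 i2
  simpa only [intervalIntegral.integral_of_le, hp0, hp, zero_le_one,
    integral_Ioc_eq_integral_Ioo] using this

lemma hasSum_eulerInt {B : ℂ} (hB : 0 < B.re) (b : ℂ) {s : ℝ} (hs0 : 0 < s) (hs1 : s < 1) :
    HasSum (fun m : ℕ => coef b m * (-(s : ℂ)) ^ m / (B + m)) (eulerInt B b s) := by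
  have hw : Summable fun m : ℕ => ‖coef b m * (-(s : ℂ)) ^ m‖ / ((m : ℝ) + 1) := by
    refine Summable.of_nonneg_of_le (fun m => by positivity) (fun m => ?_)
      (summable_norm_coef_mul_pow b hs0.le hs1)
    rw [norm_mul, norm_pow, norm_neg, Complex.norm_of_nonneg hs0.le]
    exact div_le_self (by positivity) (by linarith [m.cast_nonneg (α := ℝ)])
  have key := hasSum_mul_integral_cpow hB (g := fun _ => 1) continuousOn_const
    (fun m => coef b m * (-(s : ℂ)) ^ m) id hw
    (h := fun t => (1 + (t : ℂ) * s) ^ (-b)) fun t ht => by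
      have h : ‖-((t : ℂ) * s)‖ < 1 := by
        rw [norm_neg, norm_mul, Complex.norm_of_nonneg ht.1.le, Complex.norm_of_nonneg hs0.le]
        nlinarith [ht.1, ht.2]
      convert hasSum_coef_mul_pow b h using 1
      · ext m
        rw [mul_assoc, id, ← mul_pow]
        ring_nf
      · rw [sub_neg_eq_add]
  simp only [mul_one] at key
  rw [eulerInt]
  convert key using 1
  ext m
  rw [integral_cpow_sub_one (by simp; positivity), mul_one_div, id]

lemma eulerInt_recurrence {A : ℂ} (hA : 0 < A.re) (b : ℂ) {X : ℝ} (hX : 0 < X) :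
    (A - b) * eulerInt A b X + b * eulerInt A (b + 1) X = (1 + (X : ℂ)) ^ (-b) := by
  have hA0 : A ≠ 0 := by rintro rfl; simp at hA
  set F : ℝ → ℂ := fun t => (t : ℂ) ^ A * (1 + (t : ℂ) * X) ^ (-b) with hF
  have hc : ContinuousOn F (Set.Icc 0 1) := by
    refine ContinuousOn.mul (fun t ht => ?_) (continuousOn_one_add_mul_cpow b hX)
    exact ((continuousAt_cpow_const_of_re_pos (Or.inl (by simpa using ht.1)) hA).comp
      Complex.continuous_ofReal.continuousAt).continuousWithinAt
  have hi := ((integrableOn_eulerInt hA b hX).const_mul (A - b)).add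
    ((integrableOn_eulerInt hA (b + 1) hX).const_mul b)
  have hder : ∀ t ∈ Set.Ioo (0 : ℝ) 1, HasDerivAt F
      ((A - b) * ((t : ℂ) ^ (A - 1) * (1 + (t : ℂ) * X) ^ (-b)) +
        b * ((t : ℂ) ^ (A - 1) * (1 + (t : ℂ) * X) ^ (-(b + 1)))) t := by
    intro t ht
    have hs := one_add_mul_mem_slitPlane hX ht.1.le
    have ht0 : (t : ℂ) ≠ 0 := by exact_mod_cast ht.1.ne'
    have U : HasDerivAt (fun y : ℂ => y ^ A) (A * (t : ℂ) ^ (A - 1)) t := by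
      simpa using (hasDerivAt_id (t : ℂ)).cpow_const (c := A) (Or.inl (by simpa using ht.1))
    have V : HasDerivAt (fun y : ℂ => (1 + y * X) ^ (-b))
        (-b * (1 + (t : ℂ) * X) ^ (-b - 1) * X) t := by
      refine HasDerivAt.cpow_const ?_ hs
      simpa using ((hasDerivAt_id (t : ℂ)).mul_const (X : ℂ)).const_add 1
    convert! (U.mul V).comp_ofReal using 1
    have hne := Complex.slitPlane_ne_zero hs
    have e1 : (t : ℂ) ^ A = (t : ℂ) ^ (A - 1) * t := by
      rw [Complex.cpow_sub _ _ ht0, Complex.cpow_one]; field_simp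
    have e2 : (1 + (t : ℂ) * X) ^ (-b) =
        (1 + (t : ℂ) * X) ^ (-(b + 1)) * (1 + (t : ℂ) * X) := by
      rw [show -b = -(b + 1) + 1 by ring, Complex.cpow_add _ _ hne, Complex.cpow_one]
    rw [show -b - 1 = -(b + 1) by ring, e1, e2]
    ring
  have key := intervalIntegral.integral_eq_sub_of_hasDerivAt_of_le zero_le_one hc hder
    ((intervalIntegrable_iff_integrableOn_Ioo_of_le zero_le_one).2 hi)
  rw [intervalIntegral.integral_of_le zero_le_one, integral_Ioc_eq_integral_Ioo,
    integral_add ((integrableOn_eulerInt hA b hX).const_mul (A - b))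
    ((integrableOn_eulerInt hA (b + 1) hX).const_mul b), integral_const_mul,
    integral_const_mul] at key
  rw [eulerInt, eulerInt, key]
  simp [hF, hA0]

lemma summable_coef_mul_pow_div_sub (b : ℂ) {α : ℂ} (hα : ∀ k : ℤ, α ≠ (k : ℂ)) {s : ℝ}
    (hs0 : 0 < s) (hs1 : s < 1) :
    Summable fun m : ℕ => coef b m * (-(s : ℂ)) ^ m / (α - m) := by
  obtain ⟨δ, hδ, h⟩ := exists_le_norm_add_intCast hα
  refine Summable.of_norm_bounded ((summable_norm_coef_mul_pow b hs0.le hs1).mul_left δ⁻¹)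
    fun m => ?_
  have h1 := h (-m)
  have h2 : δ ≤ ‖α - m‖ := by
    push_cast at h1
    rw [← sub_eq_add_neg] at h1
    nlinarith [abs_nonneg (-(m : ℝ))]
  rw [norm_div, norm_mul, norm_pow, norm_neg, Complex.norm_of_nonneg hs0.le]
  calc _ ≤ ‖coef b m‖ * s ^ m / δ := by gcongr
    _ = _ := by field_simp

lemma tsum_coef_mul_pow_div_sub_recurrence (b : ℂ) {α : ℂ} (hα : ∀ k : ℤ, α ≠ (k : ℂ)) {s : ℝ}
    (hs0 : 0 < s) (hs1 : s < 1) :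
    α * ∑' m : ℕ, coef b m * (-(s : ℂ)) ^ m / (α - m) = (1 + (s : ℂ)) ^ (-b) -
      b * s * ∑' m : ℕ, coef (b + 1) m * (-(s : ℂ)) ^ m / (α - 1 - m) := by
  have hα1 (k : ℤ) : α - 1 ≠ (k : ℂ) := fun h => hα (k + 1) (by push_cast; rw [← h]; ring)
  have hnz (m : ℕ) : α - m ≠ 0 := fun h => hα m (by push_cast; linear_combination h)
  have hs : ‖-(s : ℂ)‖ < 1 := by rwa [norm_neg, Complex.norm_of_nonneg hs0.le]
  have h1 := (summable_coef_mul_pow_div_sub b hα hs0 hs1).mul_left α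
  have h2 := hasSum_coef_mul_pow b hs
  rw [sub_neg_eq_add] at h2
  have h3 := h1.sub h2.summable
  have h4 := h3.tsum_eq_zero_add
  rw [h1.tsum_sub h2.summable, tsum_mul_left, h2.tsum_eq] at h4
  rw [← sub_add_cancel (α * _) ((1 + (s : ℂ)) ^ (-b)), h4, ← tsum_mul_left]
  have h0 : α ≠ 0 := by simpa using hα 0
  have e0 : α * (coef b 0 * (-(s : ℂ)) ^ 0 / (α - ((0 : ℕ) : ℂ))) - coef b 0 * (-(s : ℂ)) ^ 0 = 0 := by
    simp [h0, mul_div_cancel₀]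
  have e1 (m : ℕ) : α * (coef b (m + 1) * (-(s : ℂ)) ^ (m + 1) / (α - ((m + 1 : ℕ) : ℂ))) -
      coef b (m + 1) * (-(s : ℂ)) ^ (m + 1) =
      -(b * s * (coef (b + 1) m * (-(s : ℂ)) ^ m / (α - 1 - m))) := by
    have n1 := hnz (m + 1)
    have n2 : α - 1 - m ≠ 0 := by
      convert n1 using 1; push_cast; ring
    have e2 : α - ((m + 1 : ℕ) : ℂ) = α - 1 - m := by push_cast; ring
    have := succ_mul_coef_succ_left b m
    rw [e2]
    field_simp
    rw [pow_succ]
    linear_combination (-(s : ℂ)) ^ m * (-(s : ℂ)) * this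
  rw [e0, tsum_congr e1, tsum_neg]
  ring

/-- The connection formula for `∫₀¹ t ^ (A - 1) * (1 + t * X) ^ (-b) dt` as `X → ∞`. -/
lemma eulerInt_eq {A b : ℂ} (hA : 0 < A.re) (hb : ∀ k : ℤ, k ≤ 0 → b ≠ (k : ℂ))
    (hAb : ∀ k : ℤ, A - b ≠ (k : ℂ)) {X : ℝ} (hX : 1 < X) :
    eulerInt A b X =
      ((X⁻¹ : ℝ) : ℂ) ^ A * (Complex.Gamma A * Complex.Gamma (b - A) / Complex.Gamma b) +
      ((X⁻¹ : ℝ) : ℂ) ^ b *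
        ∑' m : ℕ, coef b m * (-((X⁻¹ : ℝ) : ℂ)) ^ m / (A - b - m) := by
  have hX0 : 0 < X := by linarith
  have hs0 : 0 < X⁻¹ := inv_pos.2 hX0
  have hs1 : X⁻¹ < 1 := inv_lt_one_of_one_lt₀ hX
  have hsc : ((X⁻¹ : ℝ) : ℂ) ≠ 0 := by exact_mod_cast hs0.ne'
  obtain ⟨N, hN⟩ := exists_nat_gt (A.re - b.re)
  induction N generalizing b with
  | zero =>
    have hbA : 0 < (b - A).re := by simp at hN ⊢; linarith
    have h1 := eulerInt_add_eulerInt hA hbA hX0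
    have h2 := (hasSum_eulerInt hbA b hs0 hs1).tsum_eq
    have h3 : ∑' m : ℕ, coef b m * (-((X⁻¹ : ℝ) : ℂ)) ^ m / (A - b - m) =
        -eulerInt (b - A) b X⁻¹ := by
      rw [← h2, ← tsum_neg]
      refine tsum_congr fun m => ?_
      rw [← div_neg]
      congr 1
      ring
    rw [h3, ← h1]
    have e1 : ((X⁻¹ : ℝ) : ℂ) ^ b = ((X⁻¹ : ℝ) : ℂ) ^ A * ((X⁻¹ : ℝ) : ℂ) ^ (b - A) := by
      rw [← Complex.cpow_add _ _ hsc]; congr 1; ring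
    have e2 : ((X⁻¹ : ℝ) : ℂ) ^ A * (X : ℂ) ^ A = 1 := by
      rw [ofReal_cpow_eq_exp hs0, ofReal_cpow_eq_exp hX0, ← Complex.exp_add, Real.log_inv]
      simp
    rw [e1]
    linear_combination (-eulerInt A b X) * e2
  | succ N ih =>
    have hb0 : b ≠ 0 := by simpa using hb 0 le_rfl
    have hbA0 : b - A ≠ 0 := fun h => hAb 0 (by push_cast; linear_combination -h)
    have hAb0 : A - b ≠ 0 := by simpa using hAb 0
    have hΓ : Complex.Gamma b ≠ 0 := Complex.Gamma_ne_zero fun m h =>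
      hb (-m) (by omega) (by push_cast; exact h)
    have h1 := eulerInt_recurrence hA b hX0
    have h2 := ih (b := b + 1) (fun k hk h => hb (k - 1) (by omega) (by push_cast; rw [← h]; ring))
      (fun k h => hAb (k + 1) (by push_cast; rw [← h]; ring)) (by simp at hN ⊢; linarith)
    have h3 := tsum_coef_mul_pow_div_sub_recurrence b hAb hs0 hs1
    rw [show A - (b + 1) = A - b - 1 by ring, show b + 1 - A = b - A + 1 by ring,
      Complex.Gamma_add_one _ hbA0, Complex.Gamma_add_one _ hb0, Complex.cpow_add _ _ hsc,
      Complex.cpow_one] at h2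
    have e1 : (1 + (X : ℂ)) ^ (-b) =
        ((X⁻¹ : ℝ) : ℂ) ^ b * (1 + ((X⁻¹ : ℝ) : ℂ)) ^ (-b) := by
      have f1 : (1 : ℂ) + X = ((1 + X : ℝ) : ℂ) := by push_cast; ring
      have f2 : (1 : ℂ) + (X⁻¹ : ℝ) = (((1 + X) / X : ℝ) : ℂ) := by
        rw [← Complex.ofReal_one, ← Complex.ofReal_add]; congr 1; field_simp; ring
      rw [f1, f2, ofReal_cpow_eq_exp (by positivity), ofReal_cpow_eq_exp hs0,
        ofReal_cpow_eq_exp (by positivity), ← Complex.exp_add, Real.log_inv,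
        Real.log_div (by positivity) (by positivity)]
      congr 1
      push_cast
      ring
    rw [e1, h2] at h1
    apply mul_left_cancel₀ hAb0
    have e3 : b * (Complex.Gamma A * ((b - A) * Complex.Gamma (b - A)) /
        (b * Complex.Gamma b)) =
        -((A - b) * (Complex.Gamma A * Complex.Gamma (b - A) / Complex.Gamma b)) := by
      field_simp
      ring
    linear_combination h1 - ((X⁻¹ : ℝ) : ℂ) ^ b * h3 - ((X⁻¹ : ℝ) : ℂ) ^ A * e3

lemma Gamma_add_natCast {a : ℂ} (ha : ∀ k : ℕ, a ≠ -(k : ℂ)) (n : ℕ) :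
    Complex.Gamma (a + n) = poch a n * Complex.Gamma a := by
  induction n with
  | zero => simp [poch]
  | succ n ih =>
    have : a + n ≠ 0 := fun h => ha n (by linear_combination h)
    push_cast
    rw [← add_assoc, Complex.Gamma_add_one _ this, ih, poch_succ]
    ring

lemma Gamma_sub_natCast_mul_poch {γ : ℂ} (hγ : ∀ k : ℤ, γ ≠ (k : ℂ)) (n : ℕ) :
    (-1) ^ n * (Complex.Gamma (γ - n) * poch (1 - γ) n) = Complex.Gamma γ := by
  induction n with
  | zero => simp [poch]
  | succ n ih =>
    have h0 : γ - n - 1 ≠ 0 := fun h => hγ (n + 1) (by push_cast; linear_combination h)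
    have h1 := Complex.Gamma_add_one _ h0
    rw [sub_add_cancel] at h1
    rw [← ih, h1, poch_succ, pow_succ]
    push_cast
    rw [show γ - (n + 1) = γ - n - 1 by ring]
    ring

lemma poch_ne_zero {β : ℂ} (hβ : ∀ k : ℤ, β ≠ (k : ℂ)) (n : ℕ) : poch β n ≠ 0 :=
  Finset.prod_ne_zero_iff.2 fun i _ h => hβ (-i) (by push_cast; linear_combination h)

lemma Gamma_ne_zero_of_ne_intCast {β : ℂ} (hβ : ∀ k : ℤ, β ≠ (k : ℂ)) :
    Complex.Gamma β ≠ 0 :=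
  Complex.Gamma_ne_zero fun m h => hβ (-m) (by push_cast; exact h)

lemma Gamma_add_intCast_mul_Gamma {β : ℂ} (j : ℤ) :
    Complex.Gamma (β + j) * Complex.Gamma (1 - β - j) =
      (-1) ^ j * (Complex.Gamma β * Complex.Gamma (1 - β)) := by
  rw [show 1 - β - j = 1 - (β + j) by ring, Complex.Gamma_mul_Gamma_one_sub,
    Complex.Gamma_mul_Gamma_one_sub, mul_add, mul_comm (Real.pi : ℂ) (j : ℂ),
    Complex.sin_antiperiodic.add_int_mul_eq]
  rcases Int.even_or_odd j with h | h
  · simp [Int.negOnePow_even j h, h.neg_one_zpow]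
  · simp [Int.negOnePow_odd j h, h.neg_one_zpow, div_neg]

lemma pochZ_mul_pochZ {α β D : ℂ} (hα : ∀ k : ℤ, α ≠ (k : ℂ)) (hβ : ∀ k : ℤ, β ≠ (k : ℂ))
    (hβα : β = α + D) (j : ℤ) :
    pochZ α j * pochZ (1 - β) (-j) * (Complex.Gamma α * Complex.Gamma D / Complex.Gamma β) =
      (-1) ^ j * (Complex.Gamma (α + j) * Complex.Gamma D / Complex.Gamma (α + j + D)) := by
  have h1 := Gamma_ne_zero_of_ne_intCast hα
  have h2 := Gamma_ne_zero_of_ne_intCast hβ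
  have h3 : Complex.Gamma (1 - β) ≠ 0 := Gamma_ne_zero_of_ne_intCast
    fun k h => hβ (1 - k) (by push_cast; rw [← h]; ring)
  have h4 : Complex.Gamma (β + j) ≠ 0 := Gamma_ne_zero_of_ne_intCast
    fun k h => hβ (k - j) (by push_cast; rw [← h]; ring)
  have h5 := Gamma_add_intCast_mul_Gamma (β := β) j
  have e : α + j + D = β + j := by rw [hβα]; ring
  rw [e, pochZ, pochZ]
  push_cast
  rw [← sub_eq_add_neg]
  field_simp
  linear_combination Complex.Gamma (α + j) * Complex.Gamma D * h5

lemma add_intCast_ne {α : ℂ} (hα : ∀ k : ℤ, α ≠ (k : ℂ)) (j : ℤ) (k : ℤ) : α + j ≠ (k : ℂ) :=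
  fun h => hα (k - j) (by push_cast; rw [← h]; ring)

/-- Relates the `G₂` terms to the Beta sums `∑ₖ (1 - D)ₖ / k! / (α + n - m + k)`. -/
lemma coef_mul_tsum_eq_G2term {b b' D α β : ℂ} (hD : 0 < D.re) (hα : ∀ k : ℤ, α ≠ (k : ℂ))
    (hβ : ∀ k : ℤ, β ≠ (k : ℂ)) (hβα : β = α + D) (s y : ℂ) (q : ℕ × ℕ) :
    coef b q.1 * (-s) ^ q.1 * (coef b' q.2 * y ^ q.2) *
        ∑' k : ℕ, coef (1 - D) k / (α + (((q.2 : ℤ) - (q.1 : ℤ) : ℤ) : ℂ) + k) =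
      Complex.Gamma α * Complex.Gamma D / Complex.Gamma β *
        G2term b b' α (1 - β) s (-y) q := by
  obtain ⟨m, n⟩ := q
  have h := pochZ_mul_pochZ hα hβ hβα ((n : ℤ) - m)
  rw [neg_sub] at h
  rw [tsum_coef_div_add hD (add_intCast_ne hα _) fun k hk => hβ (k - ((n : ℤ) - m)) (by
    rw [hβα]; push_cast at hk ⊢; linear_combination hk)]
  have e1 : ((-1 : ℂ)) ^ ((n : ℤ) - (m : ℤ)) = (-1) ^ n * (-1) ^ m := by
    rw [zpow_sub₀ (by norm_num), zpow_natCast, zpow_natCast, div_eq_mul_inv, ← inv_pow]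
    norm_num
  have e2 : ((-1 : ℂ) ^ m) * (-1) ^ m = 1 := by rw [← mul_pow]; norm_num
  have e3 : ((-1 : ℂ) ^ n) * (-1) ^ n = 1 := by rw [← mul_pow]; norm_num
  rw [e1] at h
  rw [G2term, coef, coef, neg_pow s, neg_pow y]
  simp only
  generalize Complex.Gamma (α + (((n : ℤ) - (m : ℤ) : ℤ) : ℂ)) * Complex.Gamma D /
    Complex.Gamma (α + (((n : ℤ) - (m : ℤ) : ℤ) : ℂ) + D) = g at h ⊢
  generalize Complex.Gamma α * Complex.Gamma D / Complex.Gamma β = g' at h ⊢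
  have f1 : (Nat.factorial n : ℂ) ≠ 0 := by exact_mod_cast n.factorial_ne_zero
  have f2 : (Nat.factorial m : ℂ) ≠ 0 := by exact_mod_cast m.factorial_ne_zero
  field_simp
  linear_combination (-(-1) ^ n * poch b m * poch b' n * s ^ m * y ^ n) * h -
    poch b m * poch b' n * s ^ m * y ^ n * g * (-1) ^ m * e3

lemma coef_mul_Gamma_eq_F1term {a b b' D : ℂ} (ha : 0 < a.re) (hab : ∀ k : ℤ, a - b ≠ (k : ℂ))
    {s : ℂ} (hs : s ≠ 0) (y : ℂ) (p : ℕ × ℕ) :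
    coef (1 - D) p.1 * (coef b' p.2 * y ^ p.2) * (s ^ (a + ((p.1 + p.2 : ℕ) : ℂ)) *
        (Complex.Gamma (a + ((p.1 + p.2 : ℕ) : ℂ)) *
          Complex.Gamma (b - (a + ((p.1 + p.2 : ℕ) : ℂ))) / Complex.Gamma b)) =
      s ^ a * (Complex.Gamma a * Complex.Gamma (b - a) / Complex.Gamma b) *
        F1term a (1 - D) b' (a - b + 1) (-s) (-(s * y)) p := by
  obtain ⟨k, n⟩ := p
  have hba (j : ℤ) : b - a ≠ (j : ℂ) := fun h => hab (-j) (by push_cast; linear_combination -h)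
  have h1 := Gamma_add_natCast (a := a) (fun k h => by
    rw [h] at ha; simp at ha; linarith [k.cast_nonneg (α := ℝ)]) (k + n)
  have h2 := Gamma_sub_natCast_mul_poch hba (k + n)
  have hp : poch (1 - (b - a)) (k + n) ≠ 0 := poch_ne_zero
    (fun j h => hba (1 - j) (by push_cast; linear_combination -h)) _
  simp only
  rw [h1, Complex.cpow_add _ _ hs, Complex.cpow_natCast, ← sub_sub, ← h2, F1term, coef, coef,
    show a - b + 1 = 1 - (b - a) by ring, neg_pow s, neg_pow (s * y), mul_pow]
  simp only
  have f1 : (Nat.factorial n : ℂ) ≠ 0 := by exact_mod_cast n.factorial_ne_zero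
  have f2 : (Nat.factorial k : ℂ) ≠ 0 := by exact_mod_cast k.factorial_ne_zero
  have e3 : ((-1 : ℂ) ^ (k + n)) * ((-1) ^ k * (-1) ^ n) = 1 := by
    rw [← pow_add, ← mul_pow]; norm_num
  by_cases hb : Complex.Gamma b = 0
  · simp [hb]
  field_simp
  rw [pow_add s]
  linear_combination -(poch (1 - D) k * poch b' n * y ^ n * s ^ a * s ^ n * s ^ k *
    poch a (k + n) * Complex.Gamma a * Complex.Gamma (b - a - ((k + n : ℕ) : ℂ))) * e3

lemma continuousOn_one_sub_mul_cpow (b' : ℂ) {y : ℂ} (hy : ‖y‖ < 1) :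
    ContinuousOn (fun t : ℝ => (1 - (t : ℂ) * y) ^ (-b')) (Set.Icc 0 1) := by
  refine ContinuousOn.cpow (by fun_prop) continuousOn_const fun t ht => ?_
  rw [sub_eq_add_neg]
  refine Complex.mem_slitPlane_of_norm_lt_one ?_
  rw [norm_neg, norm_mul, Complex.norm_of_nonneg ht.1]
  nlinarith [ht.1, ht.2, norm_nonneg y]

lemma hasSum_mul_prod {f g : ℕ → ℂ} {u v : ℂ} (hf : HasSum f u) (hg : HasSum g v) :
    HasSum (fun p : ℕ × ℕ => f p.1 * g p.2) (u * v) :=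
  hf.mul hg (summable_mul_of_summable_norm hf.summable.norm hg.summable.norm)

lemma summable_mul_prod_of_nonneg {ι κ : Type*} {f : ι → ℝ} {g : κ → ℝ} (hf : Summable f)
    (hg : Summable g) (hf0 : ∀ i, 0 ≤ f i) (hg0 : ∀ i, 0 ≤ g i) :
    Summable fun p : ι × κ => f p.1 * g p.2 :=
  hf.mul_of_nonneg hg hf0 hg0

/-- Termwise integration of the double series for `(1 - t) ^ (D - 1) * (1 - t * y) ^ (-b')`. -/
lemma hasSum_mul_eulerInt {a D : ℂ} (ha : 0 < a.re) (hD : 0 < D.re) (b b' : ℂ) {X : ℝ}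
    (hX : 0 < X) {y : ℂ} (hy : ‖y‖ < 1) :
    HasSum (fun p : ℕ × ℕ => coef (1 - D) p.1 * (coef b' p.2 * y ^ p.2) *
        eulerInt (a + ((p.1 + p.2 : ℕ) : ℂ)) b X)
      (∫ t in Set.Ioo (0 : ℝ) 1, (t : ℂ) ^ (a - 1) * (1 + (t : ℂ) * X) ^ (-b) *
        ((1 - (t : ℂ)) ^ (D - 1) * (1 - (t : ℂ) * y) ^ (-b'))) := by
  have hw : Summable fun p : ℕ × ℕ =>
      ‖coef (1 - D) p.1 * (coef b' p.2 * y ^ p.2)‖ / (((p.1 + p.2 : ℕ) : ℝ) + 1) := by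
    have h0 := summable_mul_prod_of_nonneg (summable_norm_coef_div hD)
      (summable_norm_coef_mul_pow b' (norm_nonneg y) hy)
      (fun _ => by positivity) (fun _ => by positivity)
    refine Summable.of_nonneg_of_le (fun p => by positivity) (fun p => ?_) h0
    rw [norm_mul, norm_mul, norm_pow, div_mul_eq_mul_div]
    push_cast
    gcongr
    linarith [p.2.cast_nonneg (α := ℝ)]
  have hh : ∀ t ∈ Set.Ioo (0 : ℝ) 1, HasSum
      (fun p : ℕ × ℕ => coef (1 - D) p.1 * (coef b' p.2 * y ^ p.2) * (t : ℂ) ^ (p.1 + p.2))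
      ((1 - (t : ℂ)) ^ (D - 1) * (1 - (t : ℂ) * y) ^ (-b')) := by
    intro t ht
    have h1 : ‖(t : ℂ)‖ < 1 := by rw [Complex.norm_of_nonneg ht.1.le]; exact ht.2
    have h2 : ‖(t : ℂ) * y‖ < 1 := by
      rw [norm_mul]; nlinarith [norm_nonneg (t : ℂ), norm_nonneg y]
    have s1 := hasSum_coef_mul_pow (1 - D) h1
    have s2 := hasSum_coef_mul_pow b' h2
    rw [neg_sub] at s1
    have h3 := hasSum_mul_prod s1 s2
    convert h3 using 1
    funext p
    rw [mul_pow, pow_add]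
    ring
  simp only [eulerInt]
  exact hasSum_mul_integral_cpow ha (continuousOn_one_add_mul_cpow b hX)
    (fun p : ℕ × ℕ => coef (1 - D) p.1 * (coef b' p.2 * y ^ p.2)) (fun p => p.1 + p.2) hw hh

lemma summable_triple {D α b b' : ℂ} (hD : 0 < D.re) (hα : ∀ k : ℤ, α ≠ (k : ℂ)) {s : ℝ}
    (hs0 : 0 ≤ s) (hs1 : s < 1) {y : ℂ} (hy : ‖y‖ < 1) :
    Summable fun p : ℕ × (ℕ × ℕ) =>
      coef (1 - D) p.1 * (coef b p.2.1 * (-(s : ℂ)) ^ p.2.1 * (coef b' p.2.2 * y ^ p.2.2)) /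
        (α + (((p.2.2 : ℤ) - (p.2.1 : ℤ) : ℤ) : ℂ) + p.1) := by
  obtain ⟨δ, hδ, h⟩ := exists_le_norm_add_intCast hα
  have h0 := summable_mul_prod_of_nonneg (summable_succ_mul_norm_coef_mul_pow b hs0 hs1)
    (summable_norm_coef_mul_pow b' (norm_nonneg y) hy)
    (fun _ => by positivity) (fun _ => by positivity)
  have h1 := (summable_mul_prod_of_nonneg (summable_norm_coef_div hD) h0
    (fun _ => by positivity) (fun _ => by positivity)).mul_left δ⁻¹
  refine Summable.of_norm_bounded h1 ?_
  rintro ⟨k, m, n⟩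
  have h2 := h (n - m + k)
  have h3 : δ * (((k : ℝ) + 1) / ((m : ℝ) + 1)) ≤
      ‖α + (((n : ℤ) - (m : ℤ) : ℤ) : ℂ) + k‖ := by
    have e : α + (((n : ℤ) - (m : ℤ) : ℤ) : ℂ) + k = α + (((n : ℤ) - m + k : ℤ) : ℂ) := by
      push_cast; ring
    rw [e]
    refine le_trans ?_ h2
    refine mul_le_mul_of_nonneg_left ?_ hδ.le
    rw [div_le_iff₀ (by positivity)]
    push_cast
    have h4 : (n : ℝ) - m + k ≤ |(n : ℝ) - m + k| := le_abs_self _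
    have h5 := mul_nonneg (abs_nonneg ((n : ℝ) - m + k)) (m.cast_nonneg (α := ℝ))
    nlinarith [n.cast_nonneg (α := ℝ)]
  simp only [norm_div, norm_mul, norm_pow, norm_neg, Complex.norm_of_nonneg hs0]
  calc _ ≤ ‖coef (1 - D) k‖ * (‖coef b m‖ * s ^ m * (‖coef b' n‖ * ‖y‖ ^ n)) /
        (δ * (((k : ℝ) + 1) / ((m : ℝ) + 1))) := by gcongr
    _ = _ := by field_simp

/-- The absolutely summable triple family underlying both sides of the connection formula. -/
def tripleTerm (D α b b' s y : ℂ) (p : ℕ × (ℕ × ℕ)) : ℂ :=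
  coef (1 - D) p.1 * (coef b p.2.1 * (-s) ^ p.2.1 * (coef b' p.2.2 * y ^ p.2.2)) /
    (α + (((p.2.2 : ℤ) - (p.2.1 : ℤ) : ℤ) : ℂ) + p.1)

lemma hasSum_mul_G2term {D α β b b' : ℂ} (hD : 0 < D.re) (hα : ∀ k : ℤ, α ≠ (k : ℂ))
    (hβ : ∀ k : ℤ, β ≠ (k : ℂ)) (hβα : β = α + D) {s y : ℂ}
    (hf : Summable (tripleTerm D α b b' s y)) :
    HasSum (fun q => Complex.Gamma α * Complex.Gamma D / Complex.Gamma β *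
      G2term b b' α (1 - β) s (-y) q) (∑' p, tripleTerm D α b b' s y p) := by
  have h1 : HasSum (fun p : (ℕ × ℕ) × ℕ => tripleTerm D α b b' s y (p.2, p.1))
      (∑' p, tripleTerm D α b b' s y p) :=
    (Equiv.prodComm (ℕ × ℕ) ℕ).hasSum_iff.2 hf.hasSum
  refine h1.prod_fiberwise fun q => ?_
  have h2 := (h1.summable.prod_factor q).hasSum
  have h3 : Complex.Gamma α * Complex.Gamma D / Complex.Gamma β * G2term b b' α (1 - β) s (-y) q =
      ∑' k, tripleTerm D α b b' s y (k, q) := by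
    rw [← coef_mul_tsum_eq_G2term hD hα hβ hβα, ← tsum_mul_left]
    refine tsum_congr fun k => ?_
    simp only [tripleTerm]
    ring
  rw [h3]
  exact h2

lemma hasSum_mul_tsum_coef_mul_pow_div {D a b b' s y : ℂ}
    (hf : Summable (tripleTerm D (a - b) b b' s y)) :
    HasSum (fun p : ℕ × ℕ => coef (1 - D) p.1 * (coef b' p.2 * y ^ p.2) *
      ∑' m : ℕ, coef b m * (-s) ^ m / (a + ((p.1 + p.2 : ℕ) : ℂ) - b - m))
      (∑' p, tripleTerm D (a - b) b b' s y p) := by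
  have h1 : HasSum (fun p : (ℕ × ℕ) × ℕ =>
      tripleTerm D (a - b) b b' s y (p.1.1, (p.2, p.1.2)))
      (∑' p, tripleTerm D (a - b) b b' s y p) :=
    ((Equiv.prodAssoc ℕ ℕ ℕ).trans ((Equiv.refl ℕ).prodCongr (Equiv.prodComm ℕ ℕ))).hasSum_iff.2
      hf.hasSum
  refine h1.prod_fiberwise fun q => ?_
  have h2 := (h1.summable.prod_factor q).hasSum
  have h3 : coef (1 - D) q.1 * (coef b' q.2 * y ^ q.2) *
      ∑' m : ℕ, coef b m * (-s) ^ m / (a + ((q.1 + q.2 : ℕ) : ℂ) - b - m) =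
      ∑' m, tripleTerm D (a - b) b b' s y (q.1, (m, q.2)) := by
    rw [← tsum_mul_left]
    refine tsum_congr fun m => ?_
    simp only [tripleTerm]
    rw [← mul_div_assoc]
    congr 1
    · ring
    · push_cast
      ring
  rw [h3]
  exact h2

/-- Connection formula for the integral, with `X = -x > 1`. -/
lemma integral_eq_F1_add_G2 {a b b' D : ℂ} (ha : 0 < a.re) (hD : 0 < D.re)
    (hb : ∀ k : ℤ, k ≤ 0 → b ≠ (k : ℂ)) (hab : ∀ k : ℤ, a - b ≠ (k : ℂ))
    (hβ : ∀ k : ℤ, a - b + D ≠ (k : ℂ)) {X : ℝ} (hX : 1 < X) {y : ℂ} (hy : ‖y‖ < 1)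
    {s : ℝ} (hs : s = X⁻¹) :
    Summable (F1term a (1 - D) b' (a - b + 1) (-s) (-(s * y))) ∧
    Summable (G2term b b' (a - b) (1 - (a - b + D)) s (-y)) ∧
    (∫ t in Set.Ioo (0 : ℝ) 1, (t : ℂ) ^ (a - 1) * (1 + (t : ℂ) * X) ^ (-b) *
        ((1 - (t : ℂ)) ^ (D - 1) * (1 - (t : ℂ) * y) ^ (-b'))) =
      (s : ℂ) ^ a * (Complex.Gamma a * Complex.Gamma (b - a) / Complex.Gamma b) *
        (∑' p, F1term a (1 - D) b' (a - b + 1) (-s) (-(s * y)) p) +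
      (s : ℂ) ^ b *
        (Complex.Gamma (a - b) * Complex.Gamma D / Complex.Gamma (a - b + D)) *
        ∑' p, G2term b b' (a - b) (1 - (a - b + D)) s (-y) p := by
  have hX0 : 0 < X := by linarith
  have hs0 : 0 < s := by rw [hs]; exact inv_pos.2 hX0
  have hs1 : s < 1 := by rw [hs]; exact inv_lt_one_of_one_lt₀ hX
  have hsC : (s : ℂ) ≠ 0 := by exact_mod_cast hs0.ne'
  have hba : ∀ k : ℤ, b - a ≠ (k : ℂ) := fun k h => hab (-k) (by push_cast; linear_combination -h)
  have hΓa : Complex.Gamma a ≠ 0 := Complex.Gamma_ne_zero_of_re_pos ha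
  have hΓD : Complex.Gamma D ≠ 0 := Complex.Gamma_ne_zero_of_re_pos hD
  have hΓb : Complex.Gamma b ≠ 0 := Complex.Gamma_ne_zero fun m h =>
    hb (-m) (by omega) (by push_cast; exact h)
  have hf : Summable (tripleTerm D (a - b) b b' s y) :=
    summable_triple hD hab hs0.le hs1 hy
  have hG := hasSum_mul_G2term hD hab hβ rfl hf
  have hT := (hasSum_mul_tsum_coef_mul_pow_div hf).mul_left ((s : ℂ) ^ b)
  have hE := hasSum_mul_eulerInt ha hD b b' hX0 hy
  have hC : (s : ℂ) ^ a * (Complex.Gamma a * Complex.Gamma (b - a) / Complex.Gamma b) ≠ 0 :=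
    mul_ne_zero (by simp [Complex.cpow_eq_zero_iff, hsC])
      (div_ne_zero (mul_ne_zero hΓa (Gamma_ne_zero_of_ne_intCast hba)) hΓb)
  have hK : Complex.Gamma (a - b) * Complex.Gamma D / Complex.Gamma (a - b + D) ≠ 0 :=
    div_ne_zero (mul_ne_zero (Gamma_ne_zero_of_ne_intCast hab) hΓD)
      (Gamma_ne_zero_of_ne_intCast hβ)
  have hF := hE.sub hT
  have hFt (p : ℕ × ℕ) : coef (1 - D) p.1 * (coef b' p.2 * y ^ p.2) *
        eulerInt (a + ((p.1 + p.2 : ℕ) : ℂ)) b X -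
      (s : ℂ) ^ b * (coef (1 - D) p.1 * (coef b' p.2 * y ^ p.2) *
        ∑' m : ℕ, coef b m * (-(s : ℂ)) ^ m / (a + ((p.1 + p.2 : ℕ) : ℂ) - b - m)) =
      (s : ℂ) ^ a * (Complex.Gamma a * Complex.Gamma (b - a) / Complex.Gamma b) *
        F1term a (1 - D) b' (a - b + 1) (-s) (-(s * y)) p := by
    have hA : 0 < (a + ((p.1 + p.2 : ℕ) : ℂ)).re := by
      rw [Complex.add_re, Complex.natCast_re]; positivity
    have hAb (k : ℤ) : a + ((p.1 + p.2 : ℕ) : ℂ) - b ≠ (k : ℂ) := fun h =>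
      hab (k - (p.1 + p.2 : ℕ)) (by push_cast at h ⊢; linear_combination h)
    rw [eulerInt_eq hA hb hAb hX, ← hs, ← coef_mul_Gamma_eq_F1term ha hab hsC]
    ring
  simp only [hFt] at hF
  have sF := (summable_mul_left_iff hC).1 hF.summable
  have sG := (summable_mul_left_iff hK).1 hG.summable
  refine ⟨sF, sG, ?_⟩
  have e1 := hF.tsum_eq
  have e2 := hG.tsum_eq
  rw [tsum_mul_left] at e1 e2
  rw [e1, mul_assoc, e2]
  ring

theorem stmt11 (a b b' c : ℂ) (ha : 0 < a.re) (hca : 0 < (c - a).re)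
    (hb : ∀ k : ℤ, k ≤ 0 → b ≠ (k : ℂ)) (hc : ∀ k : ℤ, k ≤ 0 → c ≠ (k : ℂ))
    (hab : ∀ k : ℤ, a - b ≠ (k : ℂ)) (hcb : ∀ k : ℤ, c - b ≠ (k : ℂ))
    (x : ℝ) (hx : x < -1) (y : ℂ) (hy : ‖y‖ < 1) :
    IntegrableOn
      (fun t : ℝ =>
        (t : ℂ) ^ (a - 1) * ((1 - t : ℝ) : ℂ) ^ (c - a - 1) *
          (1 - (t : ℂ) * (x : ℂ)) ^ (-b) * (1 - (t : ℂ) * y) ^ (-b'))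
      (Set.Ioo 0 1) ∧
    Summable (fun p : ℕ × ℕ =>
      ‖F1term a (a - c + 1) b' (a - b + 1) (1 / (x : ℂ)) (y / (x : ℂ)) p‖) ∧
    Summable (fun p : ℕ × ℕ =>
      ‖G2term b b' (a - b) (b - c + 1) (-(1 / (x : ℂ))) (-y) p‖) ∧
    Complex.Gamma c / (Complex.Gamma a * Complex.Gamma (c - a)) *
        ∫ t in Set.Ioo (0 : ℝ) 1,
          (t : ℂ) ^ (a - 1) * ((1 - t : ℝ) : ℂ) ^ (c - a - 1) *
            (1 - (t : ℂ) * (x : ℂ)) ^ (-b) * (1 - (t : ℂ) * y) ^ (-b')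
      = ((-1 / x : ℝ) : ℂ) ^ a *
            (Complex.Gamma c * Complex.Gamma (b - a) /
              (Complex.Gamma b * Complex.Gamma (c - a))) *
            (∑' p : ℕ × ℕ,
              F1term a (a - c + 1) b' (a - b + 1) (1 / (x : ℂ)) (y / (x : ℂ)) p) +
          ((-1 / x : ℝ) : ℂ) ^ b *
            (Complex.Gamma c * Complex.Gamma (a - b) /
              (Complex.Gamma a * Complex.Gamma (c - b))) *
            (∑' p : ℕ × ℕ,
              G2term b b' (a - b) (b - c + 1) (-(1 / (x : ℂ))) (-y) p) := by

  have hX : 1 < -x := by linarith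
  have hx0 : (x : ℂ) ≠ 0 := by exact_mod_cast (by linarith : x ≠ 0)
  have hΓa : Complex.Gamma a ≠ 0 := Complex.Gamma_ne_zero_of_re_pos ha
  have hΓD : Complex.Gamma (c - a) ≠ 0 := Complex.Gamma_ne_zero_of_re_pos hca
  have hi (t : ℝ) : (t : ℂ) ^ (a - 1) * ((1 - t : ℝ) : ℂ) ^ (c - a - 1) *
      (1 - (t : ℂ) * (x : ℂ)) ^ (-b) * (1 - (t : ℂ) * y) ^ (-b') =
      (t : ℂ) ^ (a - 1) * (1 + (t : ℂ) * ((-x : ℝ) : ℂ)) ^ (-b) *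
        ((1 - (t : ℂ)) ^ (c - a - 1) * (1 - (t : ℂ) * y) ^ (-b')) := by
    rw [show 1 + (t : ℂ) * ((-x : ℝ) : ℂ) = 1 - (t : ℂ) * (x : ℂ) by push_cast; ring]
    push_cast
    ring
  have hcb' : a - b + (c - a) = c - b := by ring
  obtain ⟨h1, h2, h3⟩ := integral_eq_F1_add_G2 (b' := b') ha hca hb hab
    (by rw [hcb']; exact hcb) hX hy (s := -1 / x) (by rw [neg_div, ← div_neg, one_div])
  rw [hcb'] at h2 h3
  have e1 : 1 - (c - a) = a - c + 1 := by ring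
  have e2 : 1 - (c - b) = b - c + 1 := by ring
  have e3 : -((-1 / x : ℝ) : ℂ) = 1 / (x : ℂ) := by push_cast; ring
  have e4 : -(((-1 / x : ℝ) : ℂ) * y) = y / (x : ℂ) := by push_cast; ring
  have e5 : -(1 / (x : ℂ)) = ((-1 / x : ℝ) : ℂ) := by rw [← e3, neg_neg]
  rw [e5]
  rw [e1, e3, e4] at h1 h3
  rw [e2] at h2 h3
  refine ⟨?_, h1.norm, h2.norm, ?_⟩
  · have h4 := (integrableOn_Ioo_beta ha hca).mul_continuousOn_of_subset
      ((continuousOn_one_add_mul_cpow b (by linarith : 0 < -x)).mul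
        (continuousOn_one_sub_mul_cpow b' hy))
      measurableSet_Ioo isCompact_Icc Set.Ioo_subset_Icc_self
    refine h4.congr_fun (fun t _ => ?_) measurableSet_Ioo
    rw [hi]
    simp only [Pi.mul_apply]
    ring
  · simp only [hi]
    rw [h3]
    field_simp
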